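/- ∫₀^∞ tanh(z)⁵/z³ dz = -7 ζ(3)/π² + 310 ζ(5)/π⁴ - 1905 ζ(7)/π⁶. -/

import Mathlib

open Real MeasureTheory

/-- The positive numbers `a` such that `a * I` is a pole of `tanh`. -/
noncomputable def tanhPole (n : ℕ) : ℝ := (n + 1 / 2) * π

lemma tanhPole_pos (n : ℕ) : 0 < tanhPole n := by
  unfold tanhPole; positivity

lemma HasSum.of_eq_of_eq {ι E : Type*} [AddCommMonoid E] [TopologicalSpace E] {f g : ι → E}
    {a b : E} (h : HasSum f a) (hfg : ∀ n, g n = f n)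
    (hab : b = a) : HasSum g b := by
  rwa [hab, funext hfg]

lemma hasSum_one_div_tanhPole_pow {s : ℕ} (hs : 1 < s) :
    HasSum (fun n : ℕ ↦ 1 / (tanhPole n : ℂ) ^ s)
      ((2 ^ s - 1) * riemannZeta s / (π : ℂ) ^ s) := by
  have hsum : Summable fun n : ℕ ↦ 1 / (n : ℂ) ^ s := by
    have := Complex.summable_one_div_nat_cpow (p := s)
    simpa [hs] using this
  have htot : HasSum (fun n : ℕ ↦ 1 / (n : ℂ) ^ s) (riemannZeta s) := by
    rw [zeta_nat_eq_tsum_of_gt_one hs]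
    exact hsum.hasSum
  have heven : HasSum (fun n : ℕ ↦ 1 / ((2 * n : ℕ) : ℂ) ^ s) (1 / 2 ^ s * riemannZeta s) := by
    refine (htot.mul_left (1 / 2 ^ s)).of_eq_of_eq (fun n ↦ ?_) rfl
    push_cast
    rw [mul_pow, one_div_mul_one_div]
  have hinj : Function.Injective fun n : ℕ ↦ 2 * n + 1 := fun m n h ↦ by simpa using h
  have hodd := (hsum.comp_injective hinj).hasSum
  have heq := htot.unique (heven.even_add_odd hodd)
  have hodd' : HasSum (fun n : ℕ ↦ 1 / ((2 * n + 1 : ℕ) : ℂ) ^ s)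
      ((1 - 1 / 2 ^ s) * riemannZeta s) := by
    refine hodd.of_eq_of_eq (fun n ↦ rfl) ?_
    linear_combination heq
  have hpi : (π : ℂ) ≠ 0 := by simp [pi_ne_zero]
  refine (hodd'.mul_left (2 ^ s / (π : ℂ) ^ s)).of_eq_of_eq (fun n ↦ ?_) ?_
  · have h : (tanhPole n : ℂ) = (2 * n + 1 : ℕ) * π / 2 := by
      unfold tanhPole; push_cast; ring
    have h2 : ((2 * n + 1 : ℕ) : ℂ) ≠ 0 := by exact_mod_cast Nat.succ_ne_zero (2 * n)
    rw [h, div_pow, mul_pow]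
    field_simp
  · field_simp

lemma riemannZeta_six : riemannZeta 6 = (π : ℂ) ^ 6 / 945 := by
  have h6 : bernoulli 6 = 1 / 42 := by
    have h5 : bernoulli' 5 = 0 := bernoulli'_eq_zero_of_odd (by decide) (by norm_num)
    have hc : Nat.choose 6 4 = 15 := by decide
    rw [bernoulli_eq_bernoulli'_of_ne_one (by norm_num), bernoulli'_def]
    norm_num [Finset.sum_range_succ, h5, hc, Nat.choose]
  have := riemannZeta_two_mul_nat (k := 3) (by norm_num)
  norm_num [h6, Nat.factorial] at this
  rw [this]
  ring

lemma hasSum_inv_tanhPole_sq : HasSum (fun n ↦ 1 / tanhPole n ^ 2) (1 / 2) := by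
  have h := hasSum_one_div_tanhPole_pow (s := 2) (by norm_num)
  have hpi : (π : ℂ) ≠ 0 := by simp [pi_ne_zero]
  rw [← Complex.hasSum_ofReal]
  convert h using 1
  · push_cast; rfl
  · rw [Nat.cast_ofNat, riemannZeta_two]; push_cast; field_simp; norm_num

lemma hasSum_inv_tanhPole_pow_four : HasSum (fun n ↦ 1 / tanhPole n ^ 4) (1 / 6) := by
  have h := hasSum_one_div_tanhPole_pow (s := 4) (by norm_num)
  have hpi : (π : ℂ) ≠ 0 := by simp [pi_ne_zero]
  rw [← Complex.hasSum_ofReal]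
  convert h using 1
  · push_cast; rfl
  · rw [Nat.cast_ofNat, riemannZeta_four]; push_cast; field_simp; norm_num

lemma hasSum_inv_tanhPole_pow_six : HasSum (fun n ↦ 1 / tanhPole n ^ 6) (1 / 15) := by
  have h := hasSum_one_div_tanhPole_pow (s := 6) (by norm_num)
  have hpi : (π : ℂ) ≠ 0 := by simp [pi_ne_zero]
  rw [← Complex.hasSum_ofReal]
  convert h using 1
  · push_cast; rfl
  · rw [Nat.cast_ofNat, riemannZeta_six]; push_cast; field_simp; norm_num

lemma integrable_one_div_sq_add_sq_pow {a : ℝ} (ha : 0 < a) (j : ℕ) :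
    Integrable fun z : ℝ ↦ 1 / (z ^ 2 + a ^ 2) ^ (j + 1) := by
  induction j with
  | zero =>
    have h := (integrable_inv_one_add_sq.comp_div ha.ne').const_mul (1 / a ^ 2)
    refine h.congr (.of_forall fun z ↦ ?_)
    have : 0 < z ^ 2 + a ^ 2 := by positivity
    have : 0 < 1 + (z / a) ^ 2 := by positivity
    field_simp
    ring
  | succ j ih =>
    refine (ih.const_mul (1 / a ^ 2)).mono' ?_ (.of_forall fun z ↦ ?_)
    · refine Continuous.aestronglyMeasurable ?_
      exact continuous_const.div (by fun_prop) fun z ↦ by positivity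
    · rw [Real.norm_of_nonneg (by positivity), one_div_mul_one_div, pow_succ' _ (j + 1)]
      gcongr
      nlinarith [sq_nonneg z]

lemma integral_one_div_sq_add_sq {a : ℝ} (ha : 0 < a) :
    ∫ z in Set.Ioi (0 : ℝ), 1 / (z ^ 2 + a ^ 2) = π / (2 * a) := by
  have h := integral_comp_mul_left_Ioi (fun x : ℝ ↦ (1 + x ^ 2)⁻¹) 0 (inv_pos.mpr ha)
  rw [mul_zero, integral_Ioi_inv_one_add_sq, arctan_zero, smul_eq_mul] at h
  have h2 : ∀ z : ℝ, 1 / (z ^ 2 + a ^ 2) = 1 / a ^ 2 * (1 + (a⁻¹ * z) ^ 2)⁻¹ := fun z ↦ by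
    have : 0 < z ^ 2 + a ^ 2 := by positivity
    have : 0 < 1 + (a⁻¹ * z) ^ 2 := by positivity
    field_simp
    ring
  simp_rw [h2]
  rw [integral_const_mul, h]
  field_simp
  ring

lemma integral_one_div_sq_add_sq_pow_succ {a : ℝ} (ha : 0 < a) (j : ℕ) :
    ∫ z in Set.Ioi (0 : ℝ), 1 / (z ^ 2 + a ^ 2) ^ (j + 2) =
      (2 * j + 1) / (2 * (j + 1) * a ^ 2) *
        ∫ z in Set.Ioi (0 : ℝ), 1 / (z ^ 2 + a ^ 2) ^ (j + 1) := by
  have hi := (integrable_one_div_sq_add_sq_pow ha j).integrableOn (s := Set.Ioi 0)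
  have hi' := (integrable_one_div_sq_add_sq_pow ha (j + 1)).integrableOn (s := Set.Ioi 0)
  have hd : ∀ z ∈ Set.Ici (0 : ℝ), HasDerivAt (fun z ↦ z / (z ^ 2 + a ^ 2) ^ (j + 1))
      (2 * (j + 1) * a ^ 2 * (1 / (z ^ 2 + a ^ 2) ^ (j + 2)) -
        (2 * j + 1) * (1 / (z ^ 2 + a ^ 2) ^ (j + 1))) z := fun z _ ↦ by
    have hs : 0 < z ^ 2 + a ^ 2 := by positivity
    have := (hasDerivAt_id z).div ((((hasDerivAt_id z).pow 2).add_const (a ^ 2)).pow (j + 1))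
      (pow_ne_zero _ hs.ne')
    refine this.congr_deriv ?_
    simp
    field_simp
    ring
  have ht : Filter.Tendsto (fun z : ℝ ↦ z / (z ^ 2 + a ^ 2) ^ (j + 1)) Filter.atTop (nhds 0) := by
    have h1 : Filter.Tendsto (fun z : ℝ ↦ 1 / (a ^ 2) ^ j * z⁻¹) Filter.atTop (nhds 0) := by
      simpa only [mul_zero] using
        (tendsto_inv_atTop_zero (𝕜 := ℝ)).const_mul (1 / (a ^ 2) ^ j)
    refine squeeze_zero' ?_ ?_ h1
    · filter_upwards [Filter.eventually_gt_atTop 0] with z hz using by positivity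
    · filter_upwards [Filter.eventually_gt_atTop 0] with z hz
      have : z / (z ^ 2 + a ^ 2) ^ (j + 1) = 1 / (z ^ 2 + a ^ 2) ^ j * (z / (z ^ 2 + a ^ 2)) := by
        rw [div_mul_div_comm, one_mul, pow_succ]
      rw [this]
      gcongr
      · nlinarith
      · rw [inv_eq_one_div, div_le_div_iff₀ (by positivity) hz]
        nlinarith [sq_nonneg a]
  have h := integral_Ioi_of_hasDerivAt_of_tendsto' hd
    ((hi'.const_mul _).sub (hi.const_mul _)) ht
  rw [integral_sub (hi'.const_mul _) (hi.const_mul _), integral_const_mul,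
    integral_const_mul] at h
  have hj : (0 : ℝ) < j + 1 := by positivity
  simp only [zero_div, sub_zero] at h
  rw [div_mul_eq_mul_div, eq_div_iff (by positivity)]
  linarith

/-- The point at which `cot (π * w)` is `-I * tanh z`. -/
noncomputable def cotArg (z : ℝ) : ℂ := 1 / 2 + z / π * Complex.I

lemma cotArg_mem_upperHalfPlane {z : ℝ} (hz : 0 < z) :
    cotArg z ∈ UpperHalfPlane.upperHalfPlaneSet := by
  have : (cotArg z).im = z / π := by
    rw [cotArg, ← Complex.ofReal_div]; simp
  change 0 < (cotArg z).im
  rw [this]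
  positivity

lemma cot_pi_mul_cotArg (z : ℝ) :
    Complex.cot (π * cotArg z) = -Complex.I * (Real.tanh z : ℂ) := by
  have hpi : (π : ℂ) ≠ 0 := by simp [pi_ne_zero]
  have h : (π : ℂ) * cotArg z = z * Complex.I + π / 2 := by
    unfold cotArg; field_simp; ring
  rw [h, Complex.cot, Complex.cos_add_pi_div_two, Complex.sin_add_pi_div_two,
    Complex.sin_mul_I, Complex.cos_mul_I, Complex.ofReal_tanh, Complex.tanh_eq_sinh_div_cosh]
  ring

lemma one_div_cotArg_add (z : ℝ) (n : ℕ) :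
    1 / (cotArg z + n) = -π * Complex.I / (z - tanhPole n * Complex.I) := by
  have hpi : (π : ℂ) ≠ 0 := by simp [pi_ne_zero]
  have h : cotArg z + n = Complex.I / π * (z - tanhPole n * Complex.I) := by
    unfold cotArg tanhPole
    push_cast
    field_simp
    linear_combination ((π : ℂ) * (2 * n + 1)) * Complex.I_sq
  rw [h, one_div, mul_inv, inv_div, Complex.div_I, div_eq_mul_inv]
  ring

lemma one_div_cotArg_sub (z : ℝ) (n : ℕ) :
    1 / (cotArg z - (n + 1)) = -π * Complex.I / (z + tanhPole n * Complex.I) := by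
  have hpi : (π : ℂ) ≠ 0 := by simp [pi_ne_zero]
  have h : cotArg z - (n + 1) = Complex.I / π * (z + tanhPole n * Complex.I) := by
    unfold cotArg tanhPole
    push_cast
    field_simp
    linear_combination (-(π : ℂ) * (2 * n + 1)) * Complex.I_sq
  rw [h, one_div, mul_inv, inv_div, Complex.div_I, div_eq_mul_inv]
  ring

lemma ofReal_sub_mul_I_ne_zero {z : ℝ} (hz : 0 < z) (a : ℝ) : (z : ℂ) - a * Complex.I ≠ 0 :=
  fun h ↦ hz.ne' (by simpa using congrArg Complex.re h)

lemma ofReal_add_mul_I_ne_zero {z : ℝ} (hz : 0 < z) (a : ℝ) : (z : ℂ) + a * Complex.I ≠ 0 :=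
  fun h ↦ hz.ne' (by simpa using congrArg Complex.re h)

lemma sq_add_sq_eq_mul (z a : ℝ) :
    (z : ℂ) ^ 2 + (a : ℂ) ^ 2 = (z - a * Complex.I) * (z + a * Complex.I) := by
  linear_combination (a : ℂ) ^ 2 * Complex.I_sq

/-- The Mittag-Leffler expansion of `tanh`. -/
lemma hasSum_tanh {z : ℝ} (hz : 0 < z) :
    HasSum (fun n ↦ 2 * z / (z ^ 2 + tanhPole n ^ 2)) (Real.tanh z) := by
  have hpi : (π : ℂ) ≠ 0 := by simp [pi_ne_zero]
  rw [hasSum_iff_tendsto_nat_of_nonneg fun n ↦ by positivity]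
  have hsum : ∀ N : ℕ, (∑ n ∈ Finset.range N, cotTerm (cotArg z) n) + 1 / cotArg z
      - 1 / (cotArg z + N) = -π * Complex.I *
        ((∑ n ∈ Finset.range N, 2 * z / (z ^ 2 + tanhPole n ^ 2) : ℝ) : ℂ) := fun N ↦ by
    induction N with
    | zero => simp
    | succ N ih =>
      rw [Finset.sum_range_succ, Finset.sum_range_succ, Complex.ofReal_add, mul_add, ← ih]
      have key : 1 / (cotArg z - (N + 1)) + 1 / (cotArg z + N) =
          -π * Complex.I * ((2 * z / (z ^ 2 + tanhPole N ^ 2) : ℝ) : ℂ) := by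
        rw [one_div_cotArg_sub, one_div_cotArg_add]
        have h1 := ofReal_sub_mul_I_ne_zero hz (tanhPole N)
        have h2 := ofReal_add_mul_I_ne_zero hz (tanhPole N)
        push_cast
        rw [sq_add_sq_eq_mul]
        generalize (tanhPole N : ℂ) = a at *
        generalize (z : ℂ) = w at *
        rw [div_add_div _ _ h2 h1, ← mul_div_assoc, div_eq_div_iff (mul_ne_zero h2 h1) (mul_ne_zero h1 h2)]
        ring
      rw [← key, cotTerm]
      push_cast
      ring
  have hlim := tendsto_logDeriv_euler_cot_sub
    (UpperHalfPlane.coe_mem_integerComplement ⟨_, cotArg_mem_upperHalfPlane hz⟩)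
  have h0 : Filter.Tendsto (fun N : ℕ ↦ 1 / (cotArg z + N)) Filter.atTop (nhds 0) := by
    simp_rw [one_div]
    refine Filter.Tendsto.comp Filter.tendsto_inv₀_cobounded ?_
    exact (tendsto_const_add_cobounded _).comp tendsto_natCast_atTop_cobounded
  have h1 := ((hlim.add_const (1 / cotArg z)).sub h0)
  simp only [hsum] at h1
  rw [cot_pi_mul_cotArg] at h1
  have h2 := (Complex.continuous_re.tendsto _).comp (h1.const_mul (Complex.I / π))
  have h3 : ∀ x : ℂ, Complex.I / π * (-π * Complex.I * x) = x := fun x ↦ by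
    field_simp
    linear_combination (-x) * Complex.I_sq
  have h4 : Complex.I / π * (π * (-Complex.I * Real.tanh z) - 1 / cotArg z + 1 / cotArg z - 0) =
      Real.tanh z := by
    rw [sub_add_cancel, sub_zero]
    refine Eq.trans ?_ (h3 (Real.tanh z))
    ring
  rw [h4] at h2
  simpa only [Function.comp_def, h3, Complex.ofReal_re] using h2

lemma hasSum_one_div_cotArg_add_pow (z : ℝ) {k : ℕ} (hk : 1 ≤ k) :
    HasSum (fun n : ℕ ↦ (-π * Complex.I) ^ (k + 1) *
      (1 / (z - tanhPole n * Complex.I) ^ (k + 1) + 1 / (z + tanhPole n * Complex.I) ^ (k + 1)))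
      (∑' n : ℤ, 1 / (cotArg z + n) ^ (k + 1)) := by
  have hs : Summable fun n : ℤ ↦ 1 / (cotArg z + n) ^ (k + 1) := by
    have := EisensteinSeries.linear_right_summable (cotArg z) 1 (k := (k + 1 : ℕ)) (by lia)
    simpa only [Int.cast_one, one_mul, zpow_natCast, one_div] using this
  refine hs.hasSum.nat_add_neg_add_one.of_eq_of_eq (fun n ↦ ?_) rfl
  have h1 := one_div_cotArg_add z n
  have h2 := one_div_cotArg_sub z n
  push_cast
  rw [← sub_eq_add_neg, ← one_div_pow (cotArg z + n), ← one_div_pow (cotArg z - _), h1, h2,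
    div_pow, div_pow]
  ring

lemma hasDerivAt_cot_pi_mul {w : ℂ} (hw : w ∈ UpperHalfPlane.upperHalfPlaneSet) :
    HasDerivAt (fun w ↦ Complex.cot (π * w)) (-π * (1 + Complex.cot (π * w) ^ 2)) w := by
  have hs : Complex.sin (π * w) ≠ 0 :=
    sin_pi_mul_ne_zero (UpperHalfPlane.coe_mem_integerComplement ⟨w, hw⟩)
  have hl : HasDerivAt (fun w : ℂ ↦ (π : ℂ) * w) π w := by
    simpa using (hasDerivAt_id w).const_mul (π : ℂ)
  have := hl.ccos.div hl.csin hs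
  refine this.congr_deriv ?_
  rw [Complex.cot_eq_cos_div_sin]
  field_simp
  ring

open Polynomial in
/-- The polynomial expressing the `n`-th derivative of `cot` in terms of `cot`. -/
noncomputable def cotDerivPoly (n : ℕ) : ℂ[X] :=
  (fun q ↦ -(1 + X ^ 2) * derivative q)^[n] X

open Polynomial in
lemma cotDerivPoly_zero : cotDerivPoly 0 = X := rfl

open Polynomial in
lemma cotDerivPoly_succ (n : ℕ) :
    cotDerivPoly (n + 1) = -(1 + X ^ 2) * derivative (cotDerivPoly n) :=
  Function.iterate_succ_apply' _ _ _

lemma iteratedDerivWithin_cot_pi_mul (k : ℕ) {w : ℂ}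
    (hw : w ∈ UpperHalfPlane.upperHalfPlaneSet) :
    iteratedDerivWithin k (fun w : ℂ ↦ π * Complex.cot (π * w)) UpperHalfPlane.upperHalfPlaneSet w =
      π ^ (k + 1) * (cotDerivPoly k).eval (Complex.cot (π * w)) := by
  induction k generalizing w with
  | zero => simp [cotDerivPoly_zero]
  | succ k ih =>
    rw [iteratedDerivWithin_succ, derivWithin_congr (fun w hw ↦ ih hw) (ih hw),
      derivWithin_of_isOpen UpperHalfPlane.isOpen_upperHalfPlaneSet hw]
    have h := (((cotDerivPoly k).hasDerivAt _).comp w (hasDerivAt_cot_pi_mul hw)).const_mul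
      ((π : ℂ) ^ (k + 1))
    refine h.deriv.trans ?_
    rw [cotDerivPoly_succ]
    simp
    ring

lemma hasSum_eval_tanh {k : ℕ} (hk : 1 ≤ k) {z : ℝ} (hz : 0 < z) :
    HasSum (fun n ↦ (-1) ^ k * (k.factorial : ℂ) * (-Complex.I) ^ (k + 1) *
      (1 / (z - tanhPole n * Complex.I) ^ (k + 1) + 1 / (z + tanhPole n * Complex.I) ^ (k + 1)))
      ((cotDerivPoly k).eval (-Complex.I * Real.tanh z)) := by
  have hpi : (π : ℂ) ≠ 0 := by simp [pi_ne_zero]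
  have hw := cotArg_mem_upperHalfPlane hz
  have h := iteratedDerivWithin_cot_pi_mul k hw
  rw [iteratedDerivWithin_cot_pi_mul_eq_mul_tsum_div_pow hk hw, cot_pi_mul_cotArg] at h
  refine ((hasSum_one_div_cotArg_add_pow z hk).mul_left
    ((-1) ^ k * (k.factorial : ℂ) / π ^ (k + 1))).of_eq_of_eq (fun n ↦ ?_) ?_
  · rw [show -(π : ℂ) * Complex.I = π * -Complex.I by ring, mul_pow]
    field_simp
  · rw [div_mul_eq_mul_div, h, mul_div_cancel_left₀ _ (pow_ne_zero _ hpi)]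

lemma hasSum_tanh_deriv_two {z : ℝ} (hz : 0 < z) :
    HasSum (fun n ↦ 4 * (z ^ 3 - 3 * z * tanhPole n ^ 2) / (z ^ 2 + tanhPole n ^ 2) ^ 3)
      (2 * Real.tanh z ^ 3 - 2 * Real.tanh z) := by
  have h := hasSum_eval_tanh (k := 2) (by norm_num) hz
  rw [← Complex.hasSum_ofReal]
  refine (h.mul_left (-Complex.I)).of_eq_of_eq (fun n ↦ ?_) ?_
  · have h1 := ofReal_sub_mul_I_ne_zero hz (tanhPole n)
    have h2 := ofReal_add_mul_I_ne_zero hz (tanhPole n)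
    have hI : (tanhPole n : ℂ) ^ 2 = -(tanhPole n * Complex.I) ^ 2 := by
      rw [mul_pow, Complex.I_sq]; ring
    push_cast
    rw [hI]
    generalize (tanhPole n : ℂ) * Complex.I = b at *
    generalize (z : ℂ) = w at *
    have h3 : -Complex.I * ((-1) ^ 2 * (Nat.factorial 2 : ℂ) * (-Complex.I) ^ (2 + 1) *
        (1 / (w - b) ^ (2 + 1) + 1 / (w + b) ^ (2 + 1))) =
        2 * (1 / (w - b) ^ 3 + 1 / (w + b) ^ 3) := by
      norm_num [Nat.factorial]
      linear_combination
        2 * (((w - b) ^ 3)⁻¹ + ((w + b) ^ 3)⁻¹) * Complex.I_pow_four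
    have h4 : w ^ 2 + -b ^ 2 = (w - b) * (w + b) := by ring
    rw [h3, h4]
    field_simp
    ring
  · simp [cotDerivPoly_succ, cotDerivPoly_zero]
    linear_combination
      (-2 * Complex.tanh z - 2 * Complex.tanh z ^ 3 * (Complex.I ^ 2 - 1)) * Complex.I_sq

lemma hasSum_tanh_deriv_four {z : ℝ} (hz : 0 < z) :
    HasSum (fun n ↦ 48 * (z ^ 5 - 10 * z ^ 3 * tanhPole n ^ 2 + 5 * z * tanhPole n ^ 4) /
        (z ^ 2 + tanhPole n ^ 2) ^ 5)
      (16 * Real.tanh z - 40 * Real.tanh z ^ 3 + 24 * Real.tanh z ^ 5) := by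
  have h := hasSum_eval_tanh (k := 4) (by norm_num) hz
  rw [← Complex.hasSum_ofReal]
  refine (h.mul_left Complex.I).of_eq_of_eq (fun n ↦ ?_) ?_
  · have h1 := ofReal_sub_mul_I_ne_zero hz (tanhPole n)
    have h2 := ofReal_add_mul_I_ne_zero hz (tanhPole n)
    have hI : (tanhPole n : ℂ) ^ 2 = -(tanhPole n * Complex.I) ^ 2 := by
      rw [mul_pow, Complex.I_sq]; ring
    have hI' : (tanhPole n : ℂ) ^ 4 = (tanhPole n * Complex.I) ^ 4 := by
      rw [mul_pow, Complex.I_pow_four]; ring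
    push_cast
    rw [hI, hI']
    generalize (tanhPole n : ℂ) * Complex.I = b at *
    generalize (z : ℂ) = w at *
    have h3 : Complex.I * ((-1) ^ 4 * (Nat.factorial 4 : ℂ) * (-Complex.I) ^ (4 + 1) *
        (1 / (w - b) ^ (4 + 1) + 1 / (w + b) ^ (4 + 1))) =
        24 * (1 / (w - b) ^ 5 + 1 / (w + b) ^ 5) := by
      norm_num [Nat.factorial]
      linear_combination
        -24 * (((w - b) ^ 5)⁻¹ + ((w + b) ^ 5)⁻¹) *
          (Complex.I ^ 2 * Complex.I_pow_four + Complex.I_sq)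
    have h4 : w ^ 2 + -b ^ 2 = (w - b) * (w + b) := by ring
    rw [h3, h4]
    field_simp
    ring
  · simp [cotDerivPoly_succ, cotDerivPoly_zero]
    ring_nf
    simp only [Complex.I_sq, Complex.I_pow_four, show Complex.I ^ 6 = -1 by
      rw [show 6 = 4 + 2 by norm_num, pow_add, Complex.I_pow_four, Complex.I_sq, one_mul]]
    ring

lemma integrals_one_div_sq_add_sq_pow {a : ℝ} (ha : 0 < a) :
    (∫ z in Set.Ioi (0 : ℝ), 1 / (z ^ 2 + a ^ 2) ^ 1) = π / (2 * a) ∧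
    (∫ z in Set.Ioi (0 : ℝ), 1 / (z ^ 2 + a ^ 2) ^ 2) = π / (4 * a ^ 3) ∧
    (∫ z in Set.Ioi (0 : ℝ), 1 / (z ^ 2 + a ^ 2) ^ 3) = 3 * π / (16 * a ^ 5) ∧
    (∫ z in Set.Ioi (0 : ℝ), 1 / (z ^ 2 + a ^ 2) ^ 4) = 5 * π / (32 * a ^ 7) ∧
    (∫ z in Set.Ioi (0 : ℝ), 1 / (z ^ 2 + a ^ 2) ^ 5) = 35 * π / (256 * a ^ 9) := by
  have h1 : (∫ z in Set.Ioi (0 : ℝ), 1 / (z ^ 2 + a ^ 2) ^ 1) = π / (2 * a) := by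
    simpa only [pow_one] using integral_one_div_sq_add_sq ha
  have h2 : (∫ z in Set.Ioi (0 : ℝ), 1 / (z ^ 2 + a ^ 2) ^ 2) = π / (4 * a ^ 3) := by
    rw [integral_one_div_sq_add_sq_pow_succ ha 0, h1]
    push_cast; field_simp; norm_num
  have h3 : (∫ z in Set.Ioi (0 : ℝ), 1 / (z ^ 2 + a ^ 2) ^ 3) = 3 * π / (16 * a ^ 5) := by
    rw [integral_one_div_sq_add_sq_pow_succ ha 1, h2]
    push_cast; field_simp; norm_num
  have h4 : (∫ z in Set.Ioi (0 : ℝ), 1 / (z ^ 2 + a ^ 2) ^ 4) = 5 * π / (32 * a ^ 7) := by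
    rw [integral_one_div_sq_add_sq_pow_succ ha 2, h3]
    push_cast; field_simp; norm_num
  have h5 : (∫ z in Set.Ioi (0 : ℝ), 1 / (z ^ 2 + a ^ 2) ^ 5) = 35 * π / (256 * a ^ 9) := by
    rw [integral_one_div_sq_add_sq_pow_succ ha 3, h4]
    push_cast; field_simp; norm_num
  exact ⟨h1, h2, h3, h4, h5⟩

/-- A linear combination of the functions `1 / (z ^ 2 + a ^ 2) ^ j`, for `1 ≤ j ≤ 5`. -/
noncomputable def ratComb (a : ℝ) (c : Fin 5 → ℝ) (z : ℝ) : ℝ :=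
  ∑ j, c j * (1 / (z ^ 2 + a ^ 2) ^ ((j : ℕ) + 1))

lemma integrableOn_ratComb {a : ℝ} (ha : 0 < a) (c : Fin 5 → ℝ) :
    IntegrableOn (ratComb a c) (Set.Ioi 0) :=
  integrable_finsetSum _ fun j _ ↦
    ((integrable_one_div_sq_add_sq_pow ha j).const_mul (c j)).integrableOn

lemma integral_ratComb {a : ℝ} (ha : 0 < a) (c : Fin 5 → ℝ) :
    ∫ z in Set.Ioi (0 : ℝ), ratComb a c z =
      π * (c 0 / (2 * a) + c 1 / (4 * a ^ 3) + 3 * c 2 / (16 * a ^ 5) + 5 * c 3 / (32 * a ^ 7)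
        + 35 * c 4 / (256 * a ^ 9)) := by
  obtain ⟨h1, h2, h3, h4, h5⟩ := integrals_one_div_sq_add_sq_pow ha
  unfold ratComb
  rw [integral_finsetSum _ fun (j : Fin 5) _ ↦
    ((integrable_one_div_sq_add_sq_pow ha j).const_mul (c j)).integrableOn]
  simp only [integral_const_mul, Fin.sum_univ_five]
  norm_num only [Fin.val_zero, Fin.val_one, Fin.val_two, Fin.coe_ofNat_eq_mod]
  rw [h1, h2, h3, h4, h5]
  ring

lemma ratComb_nonneg {a : ℝ} {c : Fin 5 → ℝ} (hc : ∀ j, 0 ≤ c j) (z : ℝ) : 0 ≤ ratComb a c z :=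
  Finset.sum_nonneg fun j _ ↦ mul_nonneg (hc j) (by positivity)

/-- The coefficients of the part of `tanhTerm` with negative sign. -/
noncomputable def negCoeff (a : ℝ) : Fin 5 → ℝ :=
  ![2 / a ^ 2 + 10 / a ^ 6, 10 / a ^ 4, 10 / a ^ 2, 8, 32 * a ^ 2]

/-- The coefficients of the part of `tanhTerm` with positive sign. -/
noncomputable def posCoeff (a : ℝ) : Fin 5 → ℝ :=
  ![10 / a ^ 4, 10 / a ^ 2, 40 / 3, 0, 0]

/-- The `n`-th term of the expansion of `tanh z ^ 5 / z ^ 3` in partial fractions. -/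
noncomputable def tanhTerm (n : ℕ) (z : ℝ) : ℝ :=
  ratComb (tanhPole n) (posCoeff (tanhPole n)) z - ratComb (tanhPole n) (negCoeff (tanhPole n)) z

lemma hasSum_tanhTerm {z : ℝ} (hz : 0 < z) :
    HasSum (fun n ↦ tanhTerm n z) (Real.tanh z ^ 5 / z ^ 3) := by
  have h := (((((hasSum_tanh hz).sub (hasSum_inv_tanhPole_sq.mul_left (2 * z))).add
    (((hasSum_tanh_deriv_two hz).add
      (hasSum_inv_tanhPole_pow_four.mul_left (12 * z))).mul_left (5 / 6))).add
    (((hasSum_tanh_deriv_four hz).sub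
      (hasSum_inv_tanhPole_pow_six.mul_left (240 * z))).mul_left (1 / 24))).div_const (z ^ 3))
  refine h.of_eq_of_eq (fun n ↦ ?_) ?_
  · have ha := tanhPole_pos n
    have hs : 0 < z ^ 2 + tanhPole n ^ 2 := by positivity
    simp only [tanhTerm, ratComb, posCoeff, negCoeff, Fin.sum_univ_five]
    simp
    generalize tanhPole n = a at *
    field_simp
    ring
  · ring

lemma negCoeff_nonneg {a : ℝ} (ha : 0 < a) (j : Fin 5) : 0 ≤ negCoeff a j := by
  fin_cases j <;> simp [negCoeff] <;> positivity

lemma posCoeff_nonneg {a : ℝ} (ha : 0 < a) (j : Fin 5) : 0 ≤ posCoeff a j := by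
  fin_cases j <;> simp [posCoeff] <;> positivity

lemma integral_ratComb_negCoeff {a : ℝ} (ha : 0 < a) :
    ∫ z in Set.Ioi (0 : ℝ), ratComb a (negCoeff a) z = π * (1 / a ^ 3) + 15 * π * (1 / a ^ 7) := by
  rw [integral_ratComb ha]
  simp [negCoeff]
  field_simp
  ring

lemma integral_ratComb_posCoeff {a : ℝ} (ha : 0 < a) :
    ∫ z in Set.Ioi (0 : ℝ), ratComb a (posCoeff a) z = 10 * π * (1 / a ^ 5) := by
  rw [integral_ratComb ha]
  simp [posCoeff]
  field_simp
  ring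

lemma summable_one_div_tanhPole_pow {s : ℕ} (hs : 1 < s) :
    Summable fun n ↦ 1 / tanhPole n ^ s := by
  rw [← Complex.summable_ofReal]
  simpa using (hasSum_one_div_tanhPole_pow hs).summable

lemma hasSum_integral_tanhTerm :
    HasSum (fun n ↦ ∫ z in Set.Ioi (0 : ℝ), tanhTerm n z)
      (∫ z in Set.Ioi (0 : ℝ), Real.tanh z ^ 5 / z ^ 3) := by
  have hp n := integrableOn_ratComb (tanhPole_pos n) (posCoeff (tanhPole n))
  have hn n := integrableOn_ratComb (tanhPole_pos n) (negCoeff (tanhPole n))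
  have hi : ∀ n, IntegrableOn (tanhTerm n) (Set.Ioi 0) := fun n ↦ (hp n).sub (hn n)
  have hsum : Summable fun n ↦ ∫ z in Set.Ioi (0 : ℝ), ‖tanhTerm n z‖ := by
    refine Summable.of_nonneg_of_le (fun n ↦ by positivity) (fun n ↦ ?_)
      (((summable_one_div_tanhPole_pow (s := 5) (by norm_num)).mul_left (10 * π)).add
        (((summable_one_div_tanhPole_pow (s := 3) (by norm_num)).mul_left π).add
          ((summable_one_div_tanhPole_pow (s := 7) (by norm_num)).mul_left (15 * π))))
    rw [← integral_ratComb_posCoeff (tanhPole_pos n), ← integral_ratComb_negCoeff (tanhPole_pos n),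
      ← integral_add (hp n) (hn n)]
    refine integral_mono (hi n).norm ((hp n).add (hn n)) fun z ↦ ?_
    have h1 := ratComb_nonneg (a := tanhPole n) (posCoeff_nonneg (tanhPole_pos n)) z
    have h2 := ratComb_nonneg (a := tanhPole n) (negCoeff_nonneg (tanhPole_pos n)) z
    simp only [tanhTerm, Real.norm_eq_abs]
    exact abs_le.mpr ⟨by linarith, by linarith⟩
  have h := hasSum_integral_of_summable_integral_norm hi hsum
  rwa [setIntegral_congr_fun measurableSet_Ioi fun z hz ↦ (hasSum_tanhTerm hz).tsum_eq] at h

lemma integral_tanhTerm (n : ℕ) :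
    ∫ z in Set.Ioi (0 : ℝ), tanhTerm n z =
      10 * π * (1 / tanhPole n ^ 5) -
        (π * (1 / tanhPole n ^ 3) + 15 * π * (1 / tanhPole n ^ 7)) := by
  have ha := tanhPole_pos n
  simp_rw [tanhTerm]
  rw [integral_sub (integrableOn_ratComb ha _) (integrableOn_ratComb ha _),
    integral_ratComb_posCoeff ha, integral_ratComb_negCoeff ha]

theorem stmt_4 :
    (↑(∫ z in Set.Ioi (0:ℝ), Real.tanh z ^ 5 / z ^ 3) : ℂ) = -7 * riemannZeta 3 / (π:ℂ) ^ 2 + 310 * riemannZeta 5 / (π:ℂ) ^ 4 - 1905 * riemannZeta 7 / (π:ℂ) ^ 6 := by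
  have hpi : (π : ℂ) ≠ 0 := by simp [pi_ne_zero]
  have h3 := (hasSum_one_div_tanhPole_pow (s := 3) (by norm_num)).mul_left (π : ℂ)
  have h5 := (hasSum_one_div_tanhPole_pow (s := 5) (by norm_num)).mul_left (10 * π : ℂ)
  have h7 := (hasSum_one_div_tanhPole_pow (s := 7) (by norm_num)).mul_left (15 * π : ℂ)
  have h := Complex.hasSum_ofReal.mpr hasSum_integral_tanhTerm
  refine h.unique ((h5.sub (h3.add h7)).of_eq_of_eq (fun n ↦ ?_) ?_)
  · rw [integral_tanhTerm]
    push_cast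
    ring
  · push_cast
    field_simp
    ring
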